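/- arXiv:2505.07130 — 2 statements merged into one kernel-verified Lean document; each statement's English description precedes it below -/
import Mathlib

section
/- Let q be a prime power and let C ⊆ F_q^n be a self-orthogonal linear [n,k]_q code with k ≥ 2 that satisfies the Ashikhmin-Barg condition, i.e. q·w_min(C) > (q−1)·w_max(C). Set n' = ⌈q·w_min(C)/(q−1)⌉ − w_max(C). Then there exists a self-orthogonal linear [n+n'+1, k]_q code C' ⊆ F_q^{n+n'+1} that is a minimal code and violates the Ashikhmin-Barg condition, i.e. q·w_min(C') ≤ (q−1)·w_max(C'). -/
open Finset BigOperators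

/-- Ceiling division on naturals: `cdiv a b = ⌈a / b⌉`. -/
def cdiv (a b : ℕ) : ℕ := (a + b - 1) / b

/-- The minimum Hamming weight of a nonzero codeword of a linear code. -/
noncomputable def wmin {F : Type} [Field F] [Fintype F] [DecidableEq F] {n : ℕ}
    (C : Submodule F (Fin n → F)) : ℕ :=
  sInf {w | ∃ c ∈ C, c ≠ (0 : Fin n → F) ∧ hammingNorm c = w}

/-- The maximum Hamming weight of a codeword of a linear code. -/
noncomputable def wmax {F : Type} [Field F] [Fintype F] [DecidableEq F] {n : ℕ}
    (C : Submodule F (Fin n → F)) : ℕ :=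
  sSup {w | ∃ c ∈ C, hammingNorm c = w}

/-- A linear code is minimal if every nonzero codeword `c` is minimal: any codeword `c'`
whose support is contained in the support of `c` is a scalar multiple of `c`. -/
def IsMinimalCode {F : Type} [Field F] [Fintype F] [DecidableEq F] {n : ℕ}
    (C : Submodule F (Fin n → F)) : Prop :=
  ∀ c ∈ C, c ≠ (0 : Fin n → F) → ∀ c' ∈ C,
    {i : Fin n | c' i ≠ 0} ⊆ {i : Fin n | c i ≠ 0} → ∃ l : F, c' = l • c

/-- A linear code is self-orthogonal if the standard inner product of any two codewords is 0. -/
def SelfOrthogonal {F : Type} [Field F] {n : ℕ} (C : Submodule F (Fin n → F)) : Prop :=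
  ∀ c ∈ C, ∀ c' ∈ C, ∑ i, c i * c' i = 0

/-- A linear `[n,k]_q` code is projective if it is the image of `x ↦ (x·g_1, …, x·g_n)` for
nonzero, pairwise linearly independent vectors `g_1, …, g_n ∈ F_q^k`. -/
def IsProjectiveCode {F : Type} [Field F] {n : ℕ} (k : ℕ) (C : Submodule F (Fin n → F)) : Prop :=
  ∃ g : Fin n → (Fin k → F),
    (∀ i, g i ≠ 0) ∧
    (∀ i j, i ≠ j → ∀ l : F, g i ≠ l • g j) ∧
    (C : Set (Fin n → F)) = {c | ∃ x : Fin k → F, c = fun i => ∑ t, x t * g i t}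

/-- `Aw C w` is the number of codewords of `C` of Hamming weight `w`. -/
noncomputable def Aw {F : Type} [Field F] [Fintype F] [DecidableEq F] {n : ℕ}
    (C : Submodule F (Fin n → F)) (w : ℕ) : ℕ :=
  Set.ncard {c : Fin n → F | c ∈ C ∧ hammingNorm c = w}

lemma hammingNorm_eq_sum {F ι : Type} [Zero F] [DecidableEq F] [Fintype ι] (v : ι → F) :
    hammingNorm v = ∑ i, if v i ≠ 0 then 1 else 0 := by
  rw [hammingNorm, Finset.card_filter]

lemma bddAbove_weights {F : Type} [Field F] [DecidableEq F] {n : ℕ}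
    (C : Submodule F (Fin n → F)) : BddAbove {w | ∃ c ∈ C, hammingNorm c = w} := by
  refine ⟨Fintype.card (Fin n), ?_⟩
  rintro w ⟨c, -, rfl⟩
  exact hammingNorm_le_card_fintype

section Weights

variable {F : Type} [Field F] [Fintype F] [DecidableEq F] {n : ℕ}

lemma wmin_le {C : Submodule F (Fin n → F)} {c : Fin n → F} (hc : c ∈ C) (h0 : c ≠ 0) :
    wmin C ≤ hammingNorm c :=
  Nat.sInf_le ⟨c, hc, h0, rfl⟩

lemma le_wmax {C : Submodule F (Fin n → F)} {c : Fin n → F} (hc : c ∈ C) :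
    hammingNorm c ≤ wmax C :=
  le_csSup (bddAbove_weights C) ⟨c, hc, rfl⟩

lemma exists_hammingNorm_eq_wmax (C : Submodule F (Fin n → F)) :
    ∃ c ∈ C, hammingNorm c = wmax C :=
  Nat.sSup_mem (s := {w | ∃ c ∈ C, hammingNorm c = w}) ⟨_, 0, C.zero_mem, rfl⟩
    (bddAbove_weights C)

lemma exists_hammingNorm_eq_wmin {C : Submodule F (Fin n → F)} (hC : C ≠ ⊥) :
    ∃ c ∈ C, c ≠ 0 ∧ hammingNorm c = wmin C := by
  obtain ⟨c, hc, h0⟩ := C.ne_bot_iff.1 hC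
  exact Nat.sInf_mem (s := {w | ∃ c ∈ C, c ≠ (0 : Fin n → F) ∧ hammingNorm c = w})
    ⟨_, c, hc, h0, rfl⟩

/-- The weights along the affine line `c' + F c` add up to `(q - 1) wt(c)` when
`supp c' ⊆ supp c`. -/
lemma sum_hammingNorm_sub_smul {c c' : Fin n → F}
    (hsupp : {i : Fin n | c' i ≠ 0} ⊆ {i : Fin n | c i ≠ 0}) :
    ∑ l : F, hammingNorm (c' - l • c) = (Fintype.card F - 1) * hammingNorm c := by
  simp_rw [hammingNorm_eq_sum]
  rw [Finset.sum_comm, Finset.mul_sum]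
  refine Finset.sum_congr rfl fun i _ => ?_
  by_cases hi : c i = 0
  · have hi' : c' i = 0 := by
      by_contra h
      exact hsupp h hi
    simp [hi, hi']
  · have key : ∀ l : F, (c' - l • c) i ≠ 0 ↔ l ∈ Finset.univ.erase (c' i / c i) := by
      intro l
      rw [Finset.mem_erase, and_iff_left (Finset.mem_univ l), Pi.sub_apply, Pi.smul_apply,
        smul_eq_mul, sub_ne_zero, ne_comm, ne_eq, ne_eq, eq_div_iff hi]
    simp_rw [key]
    rw [← Finset.card_filter, Finset.filter_univ_mem,
      Finset.card_erase_of_mem (Finset.mem_univ _)]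
    simp [hi]

/-- The Ashikhmin-Barg lemma. -/
lemma isMinimalCode_of_ashikhmin_barg {C : Submodule F (Fin n → F)}
    (hAB : Fintype.card F * wmin C > (Fintype.card F - 1) * wmax C) : IsMinimalCode C := by
  intro c hc _ c' hc' hsupp
  by_contra! hne
  have h1 : Fintype.card F * wmin C ≤ ∑ l : F, hammingNorm (c' - l • c) := by
    rw [← smul_eq_mul, ← Finset.card_univ]
    exact Finset.card_nsmul_le_sum _ _ _ fun l _ =>
      wmin_le (C.sub_mem hc' (C.smul_mem l hc)) (sub_ne_zero.2 (hne l))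
  rw [sum_hammingNorm_sub_smul hsupp] at h1
  have h2 := Nat.mul_le_mul_left (Fintype.card F - 1) (le_wmax hc)
  omega

/-- In a code of dimension at least two some word of minimum weight and some word of maximum
weight are linearly independent. -/
lemma exists_wmin_wmax_independent {C : Submodule F (Fin n → F)}
    (hdim : 2 ≤ Module.finrank F C) :
    ∃ c₀ ∈ C, ∃ c₁ ∈ C, c₀ ≠ 0 ∧ hammingNorm c₀ = wmin C ∧ hammingNorm c₁ = wmax C ∧
      ∀ l : F, c₁ ≠ l • c₀ := by
  have hC : C ≠ ⊥ := by
    rintro rfl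
    simp at hdim
  obtain ⟨c₀, hc₀, h0, hmin⟩ := exists_hammingNorm_eq_wmin hC
  obtain ⟨c₁, hc₁, hmax⟩ := exists_hammingNorm_eq_wmax C
  by_cases hind : ∀ l : F, c₁ ≠ l • c₀
  · exact ⟨c₀, hc₀, c₁, hc₁, h0, hmin, hmax, hind⟩
  push Not at hind
  obtain ⟨l, hl⟩ := hind
  have hle : wmax C ≤ wmin C := by
    rw [← hmax, hl, ← hmin]
    exact hammingNorm_smul_le_hammingNorm (k := l) (x := c₀)
  obtain ⟨c₂, hc₂, hspan⟩ : ∃ c₂ ∈ C, c₂ ∉ Submodule.span F {c₀} := by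
    by_contra! hsub
    have h1 := Submodule.finrank_mono (show C ≤ Submodule.span F {c₀} from hsub)
    rw [finrank_span_singleton h0] at h1
    omega
  have hind : ∀ l : F, c₂ ≠ l • c₀ := fun l h =>
    hspan (Submodule.mem_span_singleton.2 ⟨l, h.symm⟩)
  have h2 : c₂ ≠ 0 := fun h => hind 0 (by simpa using h)
  exact ⟨c₀, hc₀, c₂, hc₂, h0, hmin, le_antisymm (le_wmax hc₂) (hle.trans (wmin_le hc₂ h2)),
    hind⟩

end Weights

section Extension

variable {F : Type} [Field F] {n N : ℕ}

/-- Scale the `j`-th coordinate of a vector by `d` and append the multiples of that coordinate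
by the entries of `a`. -/
def extendAt (j : Fin n) (d : F) (a : Fin N → F) : (Fin n → F) →ₗ[F] (Fin (n + N) → F) where
  toFun v := Fin.append (fun i => (if i = j then d else 1) * v i) (fun i => a i * v j)
  map_add' u v := by
    ext i
    refine Fin.addCases (fun i => ?_) (fun i => ?_) i <;> simp [mul_add]
  map_smul' l v := by
    ext i
    refine Fin.addCases (fun i => ?_) (fun i => ?_) i <;> simp [mul_left_comm]

@[simp] lemma extendAt_castAdd (j : Fin n) (d : F) (a : Fin N → F) (v : Fin n → F) (i : Fin n) :
    extendAt j d a v (Fin.castAdd N i) = (if i = j then d else 1) * v i := by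
  simp [extendAt]

@[simp] lemma extendAt_natAdd (j : Fin n) (d : F) (a : Fin N → F) (v : Fin n → F) (i : Fin N) :
    extendAt j d a v (Fin.natAdd n i) = a i * v j := by
  simp [extendAt]

lemma extendAt_castAdd_ne_zero {d : F} (hd : d ≠ 0) (j : Fin n) (a : Fin N → F)
    (v : Fin n → F) (i : Fin n) : extendAt j d a v (Fin.castAdd N i) ≠ 0 ↔ v i ≠ 0 := by
  rw [extendAt_castAdd]
  split_ifs <;> simp [hd]

lemma extendAt_injective {d : F} (hd : d ≠ 0) (j : Fin n) (a : Fin N → F) :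
    Function.Injective (extendAt j d a) := by
  rw [← LinearMap.ker_eq_bot, LinearMap.ker_eq_bot']
  intro v hv
  ext i
  by_contra hi
  exact (extendAt_castAdd_ne_zero hd j a v i).2 hi (by rw [hv, Pi.zero_apply])

lemma hammingNorm_extendAt [DecidableEq F] {d : F} (hd : d ≠ 0) (j : Fin n)
    (a : Fin N → F) (v : Fin n → F) :
    hammingNorm (extendAt j d a v) =
      hammingNorm v + if v j = 0 then 0 else hammingNorm a := by
  simp_rw [hammingNorm_eq_sum, Fin.sum_univ_add, extendAt_castAdd_ne_zero hd]
  congr 1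
  split_ifs with h <;> simp [h]

lemma sum_extendAt_mul (j : Fin n) {d : F} {a : Fin N → F} (hda : d ^ 2 + ∑ i, a i ^ 2 = 1)
    (u v : Fin n → F) :
    ∑ i, extendAt j d a u i * extendAt j d a v i = ∑ i, u i * v i := by
  rw [Fin.sum_univ_add]
  simp_rw [extendAt_castAdd, extendAt_natAdd]
  rw [← Finset.add_sum_erase _ _ (Finset.mem_univ j),
    ← Finset.add_sum_erase _ (fun i => u i * v i) (Finset.mem_univ j)]
  have h1 : ∑ i ∈ Finset.univ.erase j, (if i = j then d else 1) * u i *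
      ((if i = j then d else 1) * v i) = ∑ i ∈ Finset.univ.erase j, u i * v i := by
    refine Finset.sum_congr rfl fun i hi => ?_
    simp [Finset.ne_of_mem_erase hi]
  have h2 : ∑ i, a i * u j * (a i * v j) = (∑ i, a i ^ 2) * (u j * v j) := by
    rw [Finset.sum_mul]
    exact Finset.sum_congr rfl fun i _ => by ring
  rw [h1, h2, if_pos rfl]
  linear_combination (u j * v j) * hda

lemma SelfOrthogonal.map_extendAt {C : Submodule F (Fin n → F)} (hC : SelfOrthogonal C)
    (j : Fin n) {d : F} {a : Fin N → F} (hda : d ^ 2 + ∑ i, a i ^ 2 = 1) :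
    SelfOrthogonal (C.map (extendAt j d a)) := by
  rintro _ ⟨u, hu, rfl⟩ _ ⟨v, hv, rfl⟩
  rw [sum_extendAt_mul j hda, hC u hu v hv]

lemma IsMinimalCode.map_extendAt [Fintype F] [DecidableEq F] {C : Submodule F (Fin n → F)}
    (hC : IsMinimalCode C) (j : Fin n) {d : F} (hd : d ≠ 0) (a : Fin N → F) :
    IsMinimalCode (C.map (extendAt j d a)) := by
  rintro _ ⟨u, hu, rfl⟩ h0 _ ⟨v, hv, rfl⟩ hsupp
  obtain ⟨l, rfl⟩ := hC u hu (fun h => h0 (by rw [h, map_zero])) v hv fun i hi =>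
    (extendAt_castAdd_ne_zero hd j a u i).1
      (hsupp ((extendAt_castAdd_ne_zero hd j a v i).2 hi))
  exact ⟨l, map_smul _ _ _⟩

end Extension

section SumsOfSquares

variable {F : Type} [Field F]

/-- A sequence of `m` nonzero entries padded by zeros to length `N`. -/
lemma exists_padded [DecidableEq F] {m N : ℕ} (hm : m ≤ N) (b : ℕ → F) (hb : ∀ i, b i ≠ 0) :
    ∃ a : Fin N → F, hammingNorm a = m ∧ ∑ i, a i ^ 2 = ∑ i ∈ range m, b i ^ 2 := by
  have hfilter : (range N).filter (· < m) = range m := by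
    ext i
    simp only [Finset.mem_filter, Finset.mem_range]
    omega
  refine ⟨fun i => if (i : ℕ) < m then b i else 0, ?_, ?_⟩
  · have h : ∀ i : Fin N, ((if (i : ℕ) < m then b i else 0) ≠ 0) ↔ (i : ℕ) < m := by
      intro i
      simp [hb]
    simp_rw [hammingNorm, h, Finset.card_filter]
    rw [Fin.sum_univ_eq_sum_range (fun i => if i < m then 1 else 0), ← Finset.card_filter,
      hfilter, Finset.card_range]
  · rw [Fin.sum_univ_eq_sum_range (fun i => (if i < m then b i else 0) ^ 2)]
    simp_rw [ite_pow, zero_pow two_ne_zero]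
    rw [← Finset.sum_filter, hfilter]

lemma pow_sq_add_sum_sq {x y : F} (hxy : x ^ 2 + y ^ 2 = 1) (m : ℕ) :
    (x ^ m) ^ 2 + ∑ i ∈ range m, (x ^ i * y) ^ 2 = 1 := by
  induction m with
  | zero => simp
  | succ m ih =>
    rw [Finset.sum_range_succ]
    linear_combination ih + (x ^ m) ^ 2 * hxy

/-- If `-1` is not a square and the field is larger than `{0, 1, -1}`, then `1` is a sum of two
nonzero squares. -/
lemma exists_sq_add_sq_eq_one (hns : ∀ x : F, x ^ 2 ≠ -1) {t : F} (h0 : t ≠ 0) (h1 : t ≠ 1)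
    (h2 : t ≠ -1) : ∃ x y : F, x ≠ 0 ∧ y ≠ 0 ∧ x ^ 2 + y ^ 2 = 1 := by
  have hd : 1 + t ^ 2 ≠ 0 := fun h => hns t (by linear_combination h)
  have htwo : (2 : F) ≠ 0 := fun h => hns 1 (by linear_combination h)
  have hn : 1 - t ^ 2 ≠ 0 := by
    have h : 1 - t ^ 2 = (1 - t) * (t - -1) := by ring
    rw [h]
    exact mul_ne_zero (sub_ne_zero.2 h1.symm) (sub_ne_zero.2 h2)
  refine ⟨(1 - t ^ 2) / (1 + t ^ 2), 2 * t / (1 + t ^ 2), div_ne_zero hn hd,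
    div_ne_zero (mul_ne_zero htwo h0) hd, ?_⟩
  field_simp
  ring

/-- `1` is a sum of `m + 1` nonzero squares for some `m ∈ {N, N + 1}`, except possibly over the
field with three elements. -/
lemma exists_one_eq_sum_sq [DecidableEq F] (N : ℕ)
    (h3 : (∀ x : F, x ^ 2 ≠ -1) → (∀ x : F, x = 0 ∨ x = 1 ∨ x = -1) → N % 3 ≠ 1) :
    ∃ d : F, ∃ a : Fin (N + 1) → F, d ≠ 0 ∧ d ^ 2 + ∑ i, a i ^ 2 = 1 ∧ N ≤ hammingNorm a := by
  by_cases hns : ∀ x : F, x ^ 2 ≠ -1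
  · by_cases hF : ∀ x : F, x = 0 ∨ x = 1 ∨ x = -1
    · have hN := h3 hns hF
      have hchar : (3 : F) = 0 := by
        have h2 : (2 : F) ≠ 0 := fun h => hns 1 (by linear_combination h)
        rcases hF 2 with h | h | h
        · exact absurd h h2
        · exact absurd (show (1 : F) = 0 by linear_combination h) one_ne_zero
        · linear_combination h
      obtain ⟨k, hk, hk'⟩ : ∃ k, N ≤ 3 * k ∧ 3 * k ≤ N + 1 := ⟨(N + 1) / 3, by omega, by omega⟩
      obtain ⟨a, ha, hs⟩ := exists_padded (F := F) hk' (fun _ => 1) fun _ => one_ne_zero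
      refine ⟨1, a, one_ne_zero, ?_, by omega⟩
      rw [hs]
      simp [hchar]
    · push Not at hF
      obtain ⟨t, ht0, ht1, ht2⟩ := hF
      obtain ⟨x, y, hx, hy, hxy⟩ := exists_sq_add_sq_eq_one hns ht0 ht1 ht2
      obtain ⟨a, ha, hs⟩ := exists_padded (Nat.le_succ N) (fun i => x ^ i * y)
        fun i => mul_ne_zero (pow_ne_zero i hx) hy
      exact ⟨x ^ N, a, pow_ne_zero N hx, by rw [hs, pow_sq_add_sum_sq hxy], ha.ge⟩
  · push Not at hns
    obtain ⟨e, he⟩ := hns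
    have he0 : e ≠ 0 := by
      rintro rfl
      simp at he
    obtain ⟨k, hk, hk'⟩ : ∃ k, N ≤ 2 * k ∧ 2 * k ≤ N + 1 := ⟨(N + 1) / 2, by omega, by omega⟩
    obtain ⟨a, ha, hs⟩ := exists_padded hk' (fun i => e ^ i) fun i => pow_ne_zero i he0
    refine ⟨1, a, one_ne_zero, ?_, by omega⟩
    rw [hs]
    simp_rw [pow_right_comm e _ 2, he]
    rw [neg_one_geom_sum, if_pos (even_two_mul k)]
    simp

end SumsOfSquares

section Ternary

variable {F : Type} [Field F] [Fintype F] [DecidableEq F]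

lemma card_eq_three_of_forall (hns : ∀ x : F, x ^ 2 ≠ -1)
    (hF : ∀ x : F, x = 0 ∨ x = 1 ∨ x = -1) : Fintype.card F = 3 := by
  have h : (1 : F) ≠ -1 := fun h => hns 1 (by simpa using h)
  have huniv : (Finset.univ : Finset F) = {0, 1, -1} := by
    ext x
    simpa using hF x
  rw [← Finset.card_univ, huniv]
  exact Finset.card_eq_three.2 ⟨0, 1, -1, zero_ne_one, by simp, h, rfl⟩

lemma three_dvd_hammingNorm {n : ℕ} (hcard : Fintype.card F = 3)
    {c : Fin n → F} (hc : ∑ i, c i * c i = 0) : 3 ∣ hammingNorm c := by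
  have hchar : CharP F 3 := by
    have : Fact (Nat.Prime 3) := ⟨Nat.prime_three⟩
    exact charP_of_card_eq_prime hcard
  rw [← CharP.cast_eq_zero_iff F 3, hammingNorm_eq_sum, Nat.cast_sum]
  refine Eq.trans (Finset.sum_congr rfl fun i _ => ?_) hc
  by_cases hi : c i = 0
  · simp [hi]
  · have h := FiniteField.pow_card_sub_one_eq_one (c i) hi
    rw [hcard] at h
    simp [hi, ← pow_two, h]

end Ternary

lemma le_mul_cdiv (a : ℕ) {b : ℕ} (hb : 0 < b) : a ≤ b * cdiv a b := by
  have h1 := Nat.div_add_mod (a + b - 1) b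
  have h2 := Nat.mod_lt (a + b - 1) hb
  unfold cdiv
  omega

/-- Corollary 1.2 / 2.1. Self-orthogonal version of the transformation. -/
theorem selfOrthogonal_minimal_code_violating_AB_from_AB
    {F : Type} [Field F] [Fintype F] [DecidableEq F] {n k : ℕ}
    (C : Submodule F (Fin n → F)) (hdim : Module.finrank F C = k) (hk : 2 ≤ k)
    (hSO : SelfOrthogonal C)
    (hAB : Fintype.card F * wmin C > (Fintype.card F - 1) * wmax C)
    (n' : ℕ) (hn' : n' = cdiv (Fintype.card F * wmin C) (Fintype.card F - 1) - wmax C) :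
    ∃ C' : Submodule F (Fin (n + n' + 1) → F),
      Module.finrank F C' = k ∧
      SelfOrthogonal C' ∧
      IsMinimalCode C' ∧
      Fintype.card F * wmin C' ≤ (Fintype.card F - 1) * wmax C' := by
  change ∃ C' : Submodule F (Fin (n + (n' + 1)) → F), _
  have hmin := isMinimalCode_of_ashikhmin_barg hAB
  obtain ⟨c₀, hc₀, c₁, hc₁, h0, hw₀, hw₁, hind⟩ := exists_wmin_wmax_independent (hdim ▸ hk)
  obtain ⟨j, hj₁, hj₀⟩ : ∃ j, c₁ j ≠ 0 ∧ c₀ j = 0 := by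
    by_contra! hsub
    obtain ⟨l, hl⟩ := hmin c₀ hc₀ h0 c₁ hc₁ fun j hj => hsub j hj
    exact hind l hl
  obtain ⟨d, a, hd, hda, ha⟩ := exists_one_eq_sum_sq (F := F) n' (by
      intro hns hF
      have hcard := card_eq_three_of_forall hns hF
      have h₀ := three_dvd_hammingNorm hcard (hSO c₀ hc₀ c₀ hc₀)
      have h₁ := three_dvd_hammingNorm hcard (hSO c₁ hc₁ c₁ hc₁)
      rw [hw₀] at h₀
      rw [hw₁] at h₁
      rw [hn', hcard, cdiv]
      omega)
  refine ⟨C.map (extendAt j d a), ?_, hSO.map_extendAt j hda, hmin.map_extendAt j hd a, ?_⟩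
  · rw [← hdim]
    exact (Submodule.equivMapOfInjective _ (extendAt_injective hd j a) C).finrank_eq.symm
  · have hwmin : wmin (C.map (extendAt j d a)) ≤ wmin C := by
      have h := wmin_le (Submodule.mem_map_of_mem (f := extendAt j d a) hc₀)
        ((map_ne_zero_iff _ (extendAt_injective hd j a)).2 h0)
      rwa [hammingNorm_extendAt hd, if_pos hj₀, hw₀] at h
    have hwmax : wmax C + hammingNorm a ≤ wmax (C.map (extendAt j d a)) := by
      have h := le_wmax (Submodule.mem_map_of_mem (f := extendAt j d a) hc₁)
      rwa [hammingNorm_extendAt hd, if_neg hj₁, hw₁] at h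
    have hq : 0 < Fintype.card F - 1 := Nat.sub_pos_of_lt Fintype.one_lt_card
    calc Fintype.card F * wmin (C.map (extendAt j d a))
        ≤ Fintype.card F * wmin C := Nat.mul_le_mul_left _ hwmin
      _ ≤ (Fintype.card F - 1) * cdiv (Fintype.card F * wmin C) (Fintype.card F - 1) :=
        le_mul_cdiv _ hq
      _ ≤ (Fintype.card F - 1) * wmax (C.map (extendAt j d a)) :=
        Nat.mul_le_mul_left _ (by omega)
end

section
/- Let m ≥ 3 and h ≥ 1 be integers and set n' = 2^{2m+h−3} − 2^{2m−3} − 2^{m−1}. Then there exists a binary linear code (q = 2) with parameters [2^{2m+h−2} − 2^{2m−3} − 2^{m−2} + n', 2m+h−2, 2^{2m+h−3} − 2^{2m−4} − 2^{m−2}]_2 and maximum weight 2^{2m+h−2} − 2^{2m−3} − 2^{m−1} that is a minimal code violating the Ashikhmin-Barg condition. -/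
open Finset BigOperators

/-- The nontrivial additive character of `ZMod 2`, with integer values. -/
def signChar (a : ZMod 2) : ℤ := if a = 0 then 1 else -1

theorem signChar_add (a b : ZMod 2) : signChar (a + b) = signChar a * signChar b := by
  revert a b; decide

theorem neg_one_le_signChar (a : ZMod 2) : -1 ≤ signChar a := by
  revert a; decide

theorem two_mul_card_filter_ne_zero {α : Type*} (s : Finset α) (f : α → ZMod 2) :
    2 * (#{p ∈ s | f p ≠ 0} : ℤ) = #s - ∑ p ∈ s, signChar (f p) := by
  have key : ∀ a : ZMod 2, 2 * (if a ≠ 0 then 1 else 0 : ℤ) = 1 - signChar a := by decide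
  rw [Finset.card_filter, Finset.card_eq_sum_ones s]
  push_cast
  rw [Finset.mul_sum, ← Finset.sum_sub_distrib]
  exact Finset.sum_congr rfl fun p _ => key (f p)

theorem two_mul_sum_filter_eq_zero {α : Type*} (s : Finset α) (q : α → ZMod 2) (f : α → ℤ) :
    2 * ∑ p ∈ s with q p = 0, f p = ∑ p ∈ s, f p + ∑ p ∈ s, signChar (q p) * f p := by
  rw [Finset.sum_filter, Finset.mul_sum, ← Finset.sum_add_distrib]
  refine Finset.sum_congr rfl fun p _ => ?_
  unfold signChar
  split_ifs <;> ring

theorem sum_signChar_linearMap {V : Type*} [AddCommGroup V] [Module (ZMod 2) V] [Fintype V]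
    (f : V →ₗ[ZMod 2] ZMod 2) (hf : f ≠ 0) : ∑ x, signChar (f x) = 0 := by
  obtain ⟨y, hy⟩ : ∃ y, f y ≠ 0 := by
    by_contra! h
    exact hf (LinearMap.ext h)
  have h := Equiv.sum_comp (Equiv.addRight y) fun x => signChar (f x)
  have hy' : signChar (f y) = -1 := if_neg hy
  simp only [Equiv.coe_addRight, map_add, signChar_add, hy', ← Finset.sum_mul] at h
  linarith

theorem sum_signChar_dotProduct {t : ℕ} (a : Fin t → ZMod 2) :
    ∑ x, signChar (a ⬝ᵥ x) = if a = 0 then 2 ^ t else 0 := by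
  split_ifs with h
  · simp [h, signChar]
  · refine sum_signChar_linearMap (dotProductBilin (ZMod 2) (ZMod 2) a) fun h0 => h ?_
    exact dotProduct_eq_zero _ fun w => LinearMap.congr_fun h0 w

/-- The Walsh transform of the hyperbolic quadratic form `(x, y) ↦ x ⬝ᵥ y`. -/
theorem sum_signChar_hyperbolic {t : ℕ} (a b : Fin t → ZMod 2) :
    ∑ p : (Fin t → ZMod 2) × (Fin t → ZMod 2),
      signChar (p.1 ⬝ᵥ p.2) * signChar (a ⬝ᵥ p.1 + b ⬝ᵥ p.2) = 2 ^ t * signChar (a ⬝ᵥ b) := by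
  have h : ∀ x y : Fin t → ZMod 2, signChar (x ⬝ᵥ y) * signChar (a ⬝ᵥ x + b ⬝ᵥ y) =
      signChar (a ⬝ᵥ x) * signChar ((x + b) ⬝ᵥ y) := by
    intro x y
    rw [add_dotProduct, signChar_add, signChar_add]
    ring
  have hb : ∀ x : Fin t → ZMod 2, x + b = 0 ↔ x = b := by
    intro x
    rw [add_eq_zero_iff_eq_neg, ZModModule.neg_eq_self]
  simp only [Fintype.sum_prod_type, h, ← Finset.mul_sum, sum_signChar_dotProduct, hb]
  simp [mul_comm]

/-- A family of columns consisting of the elements of `S` together with `r` further copies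
of `v`. -/
theorem exists_columns {α : Type*} [DecidableEq α] (S : Finset α) (v : α) {r N : ℕ}
    (hN : N = #S + r) :
    ∃ g : Fin N → α, ∀ (P : α → Prop) [DecidablePred P],
      #{i | P (g i)} = #{p ∈ S | P p} + if P v then r else 0 := by
  have e : Fin N ≃ S ⊕ Fin r := Fintype.equivOfCardEq (by simp [hN])
  refine ⟨fun i => Sum.elim Subtype.val (fun _ => v) (e i), fun P _ => ?_⟩
  rw [Finset.card_filter, Finset.card_filter,
    Equiv.sum_comp e fun j => if P (Sum.elim Subtype.val (fun _ => v) j) then 1 else 0,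
    Fintype.sum_sum_type, ← Finset.sum_coe_sort S]
  congr 1
  split_ifs with h <;> simp [h]

/-- Repeating one column of a binary code satisfying the Ashikhmin-Barg condition gives a minimal
code. -/
theorem exists_minimal_code {V α : Type*} [AddCommGroup V] [Module (ZMod 2) V]
    [DecidableEq α] (B : V →ₗ[ZMod 2] α → ZMod 2) (S : Finset α) (v : α) {r N d M : ℕ}
    (hN : N = #S + r) (hd0 : 0 < d) (hMd : M < 2 * d)
    (hd : ∀ u ≠ 0, d ≤ #{p ∈ S | B u p ≠ 0}) (hM : ∀ u, #{p ∈ S | B u p ≠ 0} ≤ M)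
    (hmin : ∃ u, #{p ∈ S | B u p ≠ 0} = d ∧ B u v = 0)
    (hmax : ∃ u, #{p ∈ S | B u p ≠ 0} = M ∧ B u v ≠ 0) :
    ∃ C : Submodule (ZMod 2) (Fin N → ZMod 2),
      Module.finrank (ZMod 2) C = Module.finrank (ZMod 2) V ∧
      wmin C = d ∧ wmax C = M + r ∧ IsMinimalCode C := by
  obtain ⟨g, hg⟩ := exists_columns S v hN
  set φ : V →ₗ[ZMod 2] Fin N → ZMod 2 := LinearMap.funLeft (ZMod 2) (ZMod 2) g ∘ₗ B with hφ
  have hw : ∀ u, hammingNorm (φ u) = #{p ∈ S | B u p ≠ 0} + if B u v ≠ 0 then r else 0 :=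
    fun u => hg fun p => B u p ≠ 0
  have hinj : ∀ u, φ u = 0 → u = 0 := by
    intro u hu
    by_contra hne
    have h1 := hw u
    rw [hu, hammingNorm_zero] at h1
    have := hd u hne
    omega
  refine ⟨LinearMap.range φ, ?_, ?_, ?_, ?_⟩
  · exact LinearMap.finrank_range_of_inj ((injective_iff_map_eq_zero φ).2 hinj)
  · obtain ⟨u, hu, huv⟩ := hmin
    refine IsLeast.csInf_eq ⟨⟨φ u, ⟨u, rfl⟩, fun h => ?_, ?_⟩, ?_⟩
    · rw [hinj u h] at hu
      simp at hu
      omega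
    · simp [hw, hu, huv]
    · rintro w ⟨_, ⟨u, rfl⟩, hne, rfl⟩
      rw [hw]
      exact le_add_right (hd u fun h => hne (by simp [h]))
  · obtain ⟨u, hu, huv⟩ := hmax
    refine IsGreatest.csSup_eq ⟨⟨φ u, ⟨u, rfl⟩, ?_⟩, ?_⟩
    · simp [hw, hu, huv]
    · rintro w ⟨_, ⟨u, rfl⟩, rfl⟩
      rw [hw]
      have := hM u
      split_ifs <;> omega
  · rintro _ ⟨u, rfl⟩ - _ ⟨u', rfl⟩ hsub
    by_cases h0 : u' = 0
    · exact ⟨0, by simp [h0]⟩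
    by_cases h1 : u - u' = 0
    · exact ⟨1, by rw [sub_eq_zero.1 h1, one_smul]⟩
    exfalso
    have hS : ∀ p ∈ S, B u p = 0 → B u' p = 0 := by
      intro p hp h
      by_contra h'
      have := hg fun p => B u' p ≠ 0 ∧ B u p = 0
      rw [Finset.card_eq_zero.2] at this
      · have hpos : 0 < #{p ∈ S | B u' p ≠ 0 ∧ B u p = 0} :=
          Finset.card_pos.2 ⟨p, by simp [hp, h, h']⟩
        omega
      · refine Finset.filter_eq_empty_iff.2 fun i _ hi => ?_
        exact hsub (show i ∈ {i | φ u' i ≠ 0} from hi.1) hi.2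
    have key : ∀ a b : ZMod 2, (a = 0 → b = 0) → (if a ≠ 0 then 1 else 0) =
        (if b ≠ 0 then 1 else 0) + if a - b ≠ 0 then 1 else 0 := by decide
    have hsum : #{p ∈ S | B u p ≠ 0} =
        #{p ∈ S | B u' p ≠ 0} + #{p ∈ S | B (u - u') p ≠ 0} := by
      simp only [Finset.card_filter, ← Finset.sum_add_distrib]
      refine Finset.sum_congr rfl fun p hp => ?_
      rw [map_sub, Pi.sub_apply]
      exact key _ _ (hS p hp)
    have := hd u' h0
    have := hd _ h1
    have := hM u
    omega

/-- The space `𝔽₂ᵗ × 𝔽₂ᵗ × 𝔽₂ʰ`. -/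
abbrev HypSpace (t h : ℕ) : Type :=
  ((Fin t → ZMod 2) × (Fin t → ZMod 2)) × (Fin h → ZMod 2)

/-- The standard inner product on `HypSpace t h`, as a linear map in the first argument. -/
def hypPairing (t h : ℕ) : HypSpace t h →ₗ[ZMod 2] HypSpace t h → ZMod 2 where
  toFun u p := u.1.1 ⬝ᵥ p.1.1 + u.1.2 ⬝ᵥ p.1.2 + u.2 ⬝ᵥ p.2
  map_add' u u' := by
    ext p
    simp only [Prod.fst_add, Prod.snd_add, add_dotProduct, Pi.add_apply]
    ring
  map_smul' c u := by
    ext p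
    simp [mul_add]

theorem hypPairing_apply {t h : ℕ} (u p : HypSpace t h) :
    hypPairing t h u p = u.1.1 ⬝ᵥ p.1.1 + u.1.2 ⬝ᵥ p.1.2 + u.2 ⬝ᵥ p.2 := rfl

/-- The singular vectors of the hyperbolic quadratic form on the first two factors. -/
def hypQuadric (t h : ℕ) : Finset (HypSpace t h) :=
  ({p | p.1 ⬝ᵥ p.2 = 0} : Finset ((Fin t → ZMod 2) × (Fin t → ZMod 2))) ×ˢ {0}

theorem two_mul_card_hypQuadric (t h : ℕ) :
    2 * (#(hypQuadric t h) : ℤ) = 2 ^ (2 * t) + 2 ^ t := by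
  have h1 := two_mul_sum_filter_eq_zero Finset.univ
    (fun p : (Fin t → ZMod 2) × (Fin t → ZMod 2) => p.1 ⬝ᵥ p.2) fun _ => 1
  have h2 := sum_signChar_hyperbolic (0 : Fin t → ZMod 2) 0
  simp [signChar] at h1 h2
  simp [hypQuadric, h1, h2]
  ring

theorem sum_signChar_prod {t : ℕ} (a b : Fin t → ZMod 2) (hab : (a, b) ≠ 0) :
    ∑ p : (Fin t → ZMod 2) × (Fin t → ZMod 2), signChar (a ⬝ᵥ p.1 + b ⬝ᵥ p.2) = 0 := by
  simp only [Fintype.sum_prod_type, signChar_add, ← Finset.mul_sum, ← Finset.sum_mul,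
    sum_signChar_dotProduct]
  split_ifs <;> simp_all

theorem four_mul_card_hypQuadric_ne_zero {t h : ℕ} (u : HypSpace t h) (hu : u.1 ≠ 0) :
    4 * (#{p ∈ hypQuadric t h | hypPairing t h u p ≠ 0} : ℤ) =
      2 ^ (2 * t) + 2 ^ t - 2 ^ t * signChar (u.1.1 ⬝ᵥ u.1.2) := by
  have h1 := two_mul_card_filter_ne_zero (hypQuadric t h) (hypPairing t h u)
  have h2 := two_mul_card_hypQuadric t h
  have h3 := two_mul_sum_filter_eq_zero Finset.univ
    (fun p : (Fin t → ZMod 2) × (Fin t → ZMod 2) => p.1 ⬝ᵥ p.2)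
    fun p => signChar (u.1.1 ⬝ᵥ p.1 + u.1.2 ⬝ᵥ p.2)
  rw [sum_signChar_hyperbolic, sum_signChar_prod _ _ hu] at h3
  have h4 : ∑ p ∈ hypQuadric t h, signChar (hypPairing t h u p) =
      ∑ p : (Fin t → ZMod 2) × (Fin t → ZMod 2) with p.1 ⬝ᵥ p.2 = 0,
        signChar (u.1.1 ⬝ᵥ p.1 + u.1.2 ⬝ᵥ p.2) := by
    simp [hypQuadric, hypPairing_apply]
  rw [h4] at h1
  linarith

theorem card_hypQuadric_ne_zero_of_fst_eq_zero {t h : ℕ} (u : HypSpace t h) (hu : u.1 = 0) :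
    #{p ∈ hypQuadric t h | hypPairing t h u p ≠ 0} = 0 := by
  refine Finset.card_eq_zero.2 (Finset.filter_eq_empty_iff.2 fun p hp => ?_)
  have h2 : p.2 = 0 := by simpa using (Finset.mem_product.1 hp).2
  simp [hypPairing_apply, hu, h2]

theorem two_mul_card_hypPairing_ne_zero {t h : ℕ} (u : HypSpace t h) (hu : u ≠ 0) :
    2 * #{p | hypPairing t h u p ≠ 0} = 2 ^ (2 * t + h) := by
  have h1 := two_mul_card_filter_ne_zero Finset.univ (hypPairing t h u)
  have h2 : ∑ p, signChar (hypPairing t h u p) = 0 := by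
    simp only [Fintype.sum_prod_type, hypPairing_apply, signChar_add, ← Finset.mul_sum,
      ← Finset.sum_mul, sum_signChar_dotProduct]
    obtain ⟨⟨a, b⟩, c⟩ := u
    split_ifs <;> simp_all
  rw [h2] at h1
  have h3 : #(Finset.univ : Finset (HypSpace t h)) = 2 ^ (2 * t + h) := by
    simp [ZMod.card]
    ring
  rw [h3] at h1
  exact_mod_cast h1.trans (sub_zero _)

theorem card_compl_hypQuadric_add {t h : ℕ} (P : HypSpace t h → Prop) [DecidablePred P] :
    #{p ∈ (hypQuadric t h)ᶜ | P p} + #{p ∈ hypQuadric t h | P p} = #{p | P p} := by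
  simp only [Finset.card_filter]
  rw [Finset.sum_compl_add_sum]

/-- Proposition 4.7. -/
theorem minimal_code_violating_AB_from_two_weight_complementary
    {m h : ℕ} (hm : 3 ≤ m) (hh : 1 ≤ h)
    (n' : ℕ) (hn' : n' = 2 ^ (2 * m + h - 3) - 2 ^ (2 * m - 3) - 2 ^ (m - 1)) :
    ∃ C : Submodule (ZMod 2)
        (Fin (2 ^ (2 * m + h - 2) - 2 ^ (2 * m - 3) - 2 ^ (m - 2) + n') → ZMod 2),
      Module.finrank (ZMod 2) C = 2 * m + h - 2 ∧
      wmin C = 2 ^ (2 * m + h - 3) - 2 ^ (2 * m - 4) - 2 ^ (m - 2) ∧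
      wmax C = 2 ^ (2 * m + h - 2) - 2 ^ (2 * m - 3) - 2 ^ (m - 1) ∧
      IsMinimalCode C ∧
      2 * wmin C ≤ (2 - 1) * wmax C := by
  obtain ⟨t, rfl⟩ : ∃ t, m = t + 3 := ⟨m - 3, by omega⟩
  obtain ⟨s, rfl⟩ : ∃ s, h = s + 1 := ⟨h - 1, by omega⟩
  set A := 2 ^ t with hA
  have hA1 : 1 ≤ A := Nat.one_le_two_pow
  have hA2 : A ≤ A ^ 2 := Nat.le_self_pow two_ne_zero A
  have hAs : A ^ 2 ≤ A ^ 2 * 2 ^ s := Nat.le_mul_of_pos_right _ (by positivity)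
  have e1 : 2 ^ (2 * (t + 3) + (s + 1) - 2) = 32 * (A ^ 2 * 2 ^ s) := by
    rw [show 2 * (t + 3) + (s + 1) - 2 = t * 2 + s + 5 by omega, hA]
    ring
  have e2 : 2 ^ (2 * (t + 3) + (s + 1) - 3) = 16 * (A ^ 2 * 2 ^ s) := by
    rw [show 2 * (t + 3) + (s + 1) - 3 = t * 2 + s + 4 by omega, hA]
    ring
  have e3 : 2 ^ (2 * (t + 3) - 3) = 8 * A ^ 2 := by
    rw [show 2 * (t + 3) - 3 = t * 2 + 3 by omega, hA]
    ring
  have e4 : 2 ^ (2 * (t + 3) - 4) = 4 * A ^ 2 := by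
    rw [show 2 * (t + 3) - 4 = t * 2 + 2 by omega, hA]
    ring
  have e5 : 2 ^ (t + 3 - 1) = 4 * A := by
    rw [show t + 3 - 1 = t + 2 by omega, hA]
    ring
  have e6 : 2 ^ (t + 3 - 2) = 2 * A := by
    rw [show t + 3 - 2 = t + 1 by omega, hA]
    ring
  have e7 : 2 ^ (2 * (t + 2) + (s + 1)) = 32 * (A ^ 2 * 2 ^ s) := by
    rw [← e1]
    congr 1
    omega
  have e8 : (2 : ℤ) ^ (2 * (t + 2)) = 16 * (A ^ 2 : ℕ) := by
    rw [hA]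
    push_cast
    ring
  have e9 : (2 : ℤ) ^ (t + 2) = 4 * A := by
    rw [hA]
    push_cast
    ring
  rw [e2, e3, e5] at hn'
  rw [e1, e2, e3, e4, e5, e6]
  generalize A ^ 2 * 2 ^ s = y at *
  generalize A ^ 2 = a at *
  set Q := hypQuadric (t + 2) (s + 1)
  have hQ : #Q = 8 * a + 2 * A := by
    have : 2 * (#Q : ℤ) = _ := two_mul_card_hypQuadric (t + 2) (s + 1)
    rw [e8, e9] at this
    omega
  have hVcard : #(Finset.univ : Finset (HypSpace (t + 2) (s + 1))) = 32 * y := by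
    rw [← e7]
    simp [ZMod.card]
    ring
  have hcompl : #Qᶜ + #Q = 32 * y := by
    rw [← hVcard, Finset.card_compl_add_card, Finset.card_univ]
  have hw : ∀ u ≠ 0, #{p ∈ Qᶜ | hypPairing (t + 2) (s + 1) u p ≠ 0} +
      #{p ∈ Q | hypPairing (t + 2) (s + 1) u p ≠ 0} = 16 * y := by
    intro u hu
    have h1 := two_mul_card_hypPairing_ne_zero u hu
    have h2 : #{p ∈ Qᶜ | hypPairing (t + 2) (s + 1) u p ≠ 0} +
        #{p ∈ Q | hypPairing (t + 2) (s + 1) u p ≠ 0} = _ := card_compl_hypQuadric_add _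
    omega
  have hwQ : ∀ u : HypSpace (t + 2) (s + 1), u.1 ≠ 0 →
      4 * (#{p ∈ Q | hypPairing (t + 2) (s + 1) u p ≠ 0} : ℤ) =
        16 * a + 4 * A - 4 * A * signChar (u.1.1 ⬝ᵥ u.1.2) := by
    intro u hu
    rw [four_mul_card_hypQuadric_ne_zero u hu, e8, e9]
  have hd : ∀ u ≠ 0, 16 * y - 4 * a - 2 * A ≤
      #{p ∈ Qᶜ | hypPairing (t + 2) (s + 1) u p ≠ 0} := by
    intro u hu
    have h1 := hw u hu
    by_cases hu1 : u.1 = 0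
    · have : #{p ∈ Q | hypPairing (t + 2) (s + 1) u p ≠ 0} = 0 :=
        card_hypQuadric_ne_zero_of_fst_eq_zero u hu1
      omega
    · have h2 := hwQ u hu1
      have h3 : -(A : ℤ) ≤ A * signChar (u.1.1 ⬝ᵥ u.1.2) := by
        nlinarith [neg_one_le_signChar (u.1.1 ⬝ᵥ u.1.2)]
      rw [mul_assoc] at h2
      omega
  have hM : ∀ u, #{p ∈ Qᶜ | hypPairing (t + 2) (s + 1) u p ≠ 0} ≤ 16 * y := by
    intro u
    by_cases hu : u = 0
    · simp [hu]
    · have := hw u hu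
      omega
  have hmin : ∃ u, #{p ∈ Qᶜ | hypPairing (t + 2) (s + 1) u p ≠ 0} =
      16 * y - 4 * a - 2 * A ∧ hypPairing (t + 2) (s + 1) u (0, Pi.single 0 1) = 0 := by
    refine ⟨((Pi.single 0 1, Pi.single 0 1), 0), ?_, by simp [hypPairing_apply]⟩
    have hu : ((Pi.single 0 1, Pi.single 0 1) :
        (Fin (t + 2) → ZMod 2) × (Fin (t + 2) → ZMod 2)) ≠ 0 := by simp
    have h1 := hw ((Pi.single 0 1, Pi.single 0 1), 0) fun h => hu (congrArg Prod.fst h)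
    have h2 := hwQ ((Pi.single 0 1, Pi.single 0 1), 0) hu
    simp only [single_one_dotProduct, Pi.single_eq_same, signChar, one_ne_zero, if_false] at h2
    omega
  have hmax : ∃ u, #{p ∈ Qᶜ | hypPairing (t + 2) (s + 1) u p ≠ 0} = 16 * y ∧
      hypPairing (t + 2) (s + 1) u (0, Pi.single 0 1) ≠ 0 := by
    refine ⟨(0, Pi.single 0 1), ?_, by simp [hypPairing_apply]⟩
    have h1 := hw (0, Pi.single 0 1) (by simp)
    have h2 : #{p ∈ Q | hypPairing (t + 2) (s + 1) (0, Pi.single 0 1) p ≠ 0} = 0 :=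
      card_hypQuadric_ne_zero_of_fst_eq_zero _ rfl
    omega
  obtain ⟨C, h1, h2, h3, h4⟩ := exists_minimal_code (hypPairing (t + 2) (s + 1)) Qᶜ
    (0, Pi.single 0 1) (r := n') (N := 32 * y - 8 * a - 2 * A + n')
    (d := 16 * y - 4 * a - 2 * A) (M := 16 * y) (by omega) (by omega) (by omega) hd hM hmin hmax
  refine ⟨C, ?_, h2, ?_, h4, ?_⟩
  · rw [h1]
    simp
    omega
  · omega
  · omega
end
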